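/- Let P be a nonempty finite set of points in Euclidean space ℝⁿ and let B(x,r) be a minimum covering ball of P. Then there exists an affinely independent subset S ⊆ P with at most n+1 points such that ‖p − x‖ = r for every p ∈ S and x belongs to the convex hull of S. -/

import Mathlib

open Filter Topology in
/-- Moving `x` slightly in a direction that makes an acute angle with `p - x` decreases the
distance to `p`. -/
theorem eventually_norm_sub_add_smul_lt {E : Type*} [NormedAddCommGroup E]
    [InnerProductSpace ℝ E] {p x v : E} (h : 0 < inner ℝ v (p - x)) :
    ∀ᶠ t : ℝ in 𝓝[>] 0, ‖p - (x + t • v)‖ < ‖p - x‖ := by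
  have hlim : Tendsto (fun t : ℝ => t * ‖v‖ ^ 2) (𝓝[>] 0) (𝓝 0) := by
    have hc : Continuous fun t : ℝ => t * ‖v‖ ^ 2 := by fun_prop
    simpa using (hc.tendsto 0).mono_left nhdsWithin_le_nhds
  filter_upwards [hlim.eventually_lt_const (mul_pos two_pos h), self_mem_nhdsWithin]
    with t ht htpos
  have htpos : 0 < t := htpos
  refine lt_of_pow_lt_pow_left₀ 2 (norm_nonneg _) ?_
  rw [← sub_sub, norm_sub_sq_real, inner_smul_right, norm_smul, real_inner_comm, mul_pow,
    Real.norm_eq_abs, sq_abs]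
  nlinarith [mul_lt_mul_of_pos_left ht htpos]

open Filter Topology in
/-- The center of a minimum covering ball lies in the convex hull of the points of the set that
are on the boundary of the ball. -/
theorem mem_convexHull_boundary_of_min_covering {E : Type*} [NormedAddCommGroup E]
    [InnerProductSpace ℝ E] [CompleteSpace E] {P : Finset E} (hP : P.Nonempty) {x : E} {r : ℝ}
    (hcov : ∀ p ∈ P, ‖p - x‖ ≤ r)
    (hmin : ∀ (y : E) (r' : ℝ), (∀ p ∈ P, ‖p - y‖ ≤ r') → r ≤ r') :
    x ∈ convexHull ℝ {p | p ∈ P ∧ ‖p - x‖ = r} := by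
  by_contra hx
  have hfin : {p | p ∈ P ∧ ‖p - x‖ = r}.Finite := P.finite_toSet.subset fun p hp => hp.1
  obtain ⟨f, u, hfx, hf⟩ := geometric_hahn_banach_point_closed (convex_convexHull ℝ _)
    (hfin.isClosed_convexHull ℝ) hx
  set v := (InnerProductSpace.toDual ℝ E).symm f
  have hv : ∀ y, inner ℝ v y = f y := fun y => InnerProductSpace.toDual_symm_apply
  have hev : ∀ᶠ t : ℝ in 𝓝[>] 0, ∀ p ∈ P, ‖p - (x + t • v)‖ < r := by
    rw [eventually_all_finset]
    intro p hp
    rcases (hcov p hp).lt_or_eq with hlt | heq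
    · have hc : Continuous fun t : ℝ => ‖p - (x + t • v)‖ := by fun_prop
      have hlim := (hc.tendsto 0).mono_left (nhdsWithin_le_nhds (s := Set.Ioi 0))
      exact hlim.eventually_lt_const (by simpa using hlt)
    · rw [← heq]
      apply eventually_norm_sub_add_smul_lt
      rw [hv, map_sub, sub_pos]
      exact hfx.trans (hf p (subset_convexHull ℝ _ ⟨hp, heq⟩))
  obtain ⟨t, ht⟩ := hev.exists
  obtain ⟨q, hq, hmax⟩ := P.exists_max_image (fun p => ‖p - (x + t • v)‖) hP
  exact (hmin _ _ hmax).not_gt (ht q hq)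

/-- A minimum covering ball of a nonempty finite set `P ⊆ ℝⁿ` is determined by an
affinely independent subset `S ⊆ P` of at most `n+1` points lying on its boundary,
whose convex hull contains the center. -/
theorem stmt1 {n : ℕ} (P : Finset (EuclideanSpace ℝ (Fin n))) (hP : P.Nonempty)
    (x : EuclideanSpace ℝ (Fin n)) (r : ℝ)
    (hcov : ∀ p ∈ P, ‖p - x‖ ≤ r)
    (hmin : ∀ (y : EuclideanSpace ℝ (Fin n)) (r' : ℝ), (∀ p ∈ P, ‖p - y‖ ≤ r') → r ≤ r') :
    ∃ S : Finset (EuclideanSpace ℝ (Fin n)), S ⊆ P ∧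
      AffineIndependent ℝ (Subtype.val : ↥(S : Set (EuclideanSpace ℝ (Fin n))) → EuclideanSpace ℝ (Fin n)) ∧
      S.card ≤ n + 1 ∧ (∀ p ∈ S, ‖p - x‖ = r) ∧
      x ∈ convexHull ℝ (S : Set (EuclideanSpace ℝ (Fin n))) := by
  have hx := mem_convexHull_boundary_of_min_covering hP hcov hmin
  rw [convexHull_eq_union] at hx
  simp only [Set.mem_iUnion, exists_prop] at hx
  obtain ⟨S, hS, hind, hxS⟩ := hx
  refine ⟨S, fun p hp => (hS hp).1, hind, ?_, fun p hp => (hS hp).2, hxS⟩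
  have hcard := hind.card_le_finrank_succ
  have hle := Submodule.finrank_le (vectorSpan ℝ (Set.range ((↑) : S → EuclideanSpace ℝ (Fin n))))
  rw [finrank_euclideanSpace_fin] at hle
  rw [Fintype.card_coe] at hcard
  lia
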